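/- arXiv:math/0404278 — 2 statements merged into one kernel-verified Lean document; each statement's English description precedes it below -/
import Mathlib

section
/- Define L(n) to be the quotient of the free Lie algebra over ℤ on generators B_{i,j} (1 ≤ i < j ≤ n, with the convention B_{j,i} = B_{i,j}) by the ideal generated by the infinitesimal braid relations. Then for any i, j, s < n, the bracket [B_{i,j}, B_{s,n}] lies in the Lie subalgebra generated by {B_{1,n}, …, B_{n-1,n}}. -/
open FreeLieAlgebra

/-- Index set for the generators `B_{i,j}`, `1 ≤ i < j ≤ n`, of the pure braid Lie algebra. -/
abbrev PBGen (n : ℕ) : Type := {p : Fin n × Fin n // p.1 < p.2}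

/-- The generator `B_{i,j}` in the free Lie algebra, with the convention `B_{j,i} = B_{i,j}`
(and `B_{i,i} = 0`, never used). -/
noncomputable def Bpre {n : ℕ} (i j : Fin n) : FreeLieAlgebra ℤ (PBGen n) :=
  if h : i < j then FreeLieAlgebra.of ℤ ⟨(i, j), h⟩
  else if h' : j < i then FreeLieAlgebra.of ℤ ⟨(j, i), h'⟩ else 0

/-- The infinitesimal braid relations. -/
def pbRelations (n : ℕ) : Set (FreeLieAlgebra ℤ (PBGen n)) :=
  {x | ∃ i j s t : Fin n, ({i, j} ∩ {s, t} : Set (Fin n)) = ∅ ∧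
      x = ⁅Bpre i j, Bpre s t⁆} ∪
  {x | ∃ i j s : Fin n, i ≠ j ∧ j ≠ s ∧ i ≠ s ∧
      x = ⁅Bpre i j, Bpre i s + Bpre s j⁆}

/-- The Lie ideal generated by the infinitesimal braid relations. -/
noncomputable def pbIdeal (n : ℕ) : LieIdeal ℤ (FreeLieAlgebra ℤ (PBGen n)) :=
  LieSubmodule.lieSpan ℤ (FreeLieAlgebra ℤ (PBGen n)) (pbRelations n)

/-- `L(n)`, the holonomy Lie algebra of the pure braid arrangement. -/
abbrev LnAlg (n : ℕ) : Type := FreeLieAlgebra ℤ (PBGen n) ⧸ pbIdeal n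

/-- The class of `B_{i,j}` in `L(n)`. -/
noncomputable def Bq {n : ℕ} (i j : Fin n) : LnAlg n :=
  LieSubmodule.Quotient.mk' (pbIdeal n) (Bpre i j)

/-- `Δ(n) = Σ_{1 ≤ i < j ≤ n} B_{i,j}` in `L(n)`. -/
noncomputable def Delta (n : ℕ) : LnAlg n :=
  ∑ p : PBGen n, LieSubmodule.Quotient.mk' (pbIdeal n) (FreeLieAlgebra.of ℤ p)

lemma Bpre_comm {n : ℕ} (i j : Fin n) : Bpre i j = Bpre j i := by
  unfold Bpre
  rcases lt_trichotomy i j with h | h | h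
  · simp [h, h.not_gt]
  · simp [h]
  · simp [h, h.not_gt]

lemma Bq_comm {n : ℕ} (i j : Fin n) : Bq i j = Bq j i := by
  rw [Bq, Bq, Bpre_comm]

lemma mk_eq_zero_of_mem_pbRelations {n : ℕ} {x : FreeLieAlgebra ℤ (PBGen n)}
    (hx : x ∈ pbRelations n) : LieSubmodule.Quotient.mk' (pbIdeal n) x = 0 :=
  (LieSubmodule.Quotient.mk_eq_zero _).2 (LieSubmodule.subset_lieSpan hx)

lemma lie_Bq_eq_zero_of_disjoint {n : ℕ} {i j s t : Fin n}
    (h : ({i, j} ∩ {s, t} : Set (Fin n)) = ∅) : ⁅Bq i j, Bq s t⁆ = 0 :=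
  mk_eq_zero_of_mem_pbRelations (Or.inl ⟨i, j, s, t, h, rfl⟩)

lemma lie_Bq_add_Bq_eq_zero {n : ℕ} {i j s : Fin n} (hij : i ≠ j) (hjs : j ≠ s) (his : i ≠ s) :
    ⁅Bq i j, Bq i s + Bq s j⁆ = 0 :=
  mk_eq_zero_of_mem_pbRelations (Or.inr ⟨i, j, s, hij, hjs, his, rfl⟩)

lemma lie_Bq_Bq_eq {n : ℕ} {i j t : Fin n} (hij : i ≠ j) (hjt : j ≠ t) (hit : i ≠ t) :
    ⁅Bq i j, Bq i t⁆ = ⁅Bq i t, Bq j t⁆ := by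
  have h := lie_Bq_add_Bq_eq_zero hit hjt.symm hij
  rw [lie_add, ← lie_skew] at h
  exact neg_add_eq_zero.1 h

/-- For `i, j, s` different from the last strand, `[B_{i,j}, B_{s,n}]` lies in the Lie
subalgebra of `L(n+1)` generated by `{B_{1,n}, …, B_{n-1,n}}`. -/
theorem bracket_mem_top_subalgebra (n : ℕ) (i j s : Fin (n + 1))
    (hi : i ≠ Fin.last n) (hj : j ≠ Fin.last n) (hs : s ≠ Fin.last n) (hij : i ≠ j) :
    ⁅Bq i j, Bq s (Fin.last n)⁆ ∈
      LieSubalgebra.lieSpan ℤ (LnAlg (n + 1))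
        {x | ∃ p : Fin (n + 1), p ≠ Fin.last n ∧ x = Bq p (Fin.last n)} := by
  have mem_top (p : Fin (n + 1)) (hp : p ≠ Fin.last n) :
      Bq p (Fin.last n) ∈ LieSubalgebra.lieSpan ℤ (LnAlg (n + 1))
        {x | ∃ p : Fin (n + 1), p ≠ Fin.last n ∧ x = Bq p (Fin.last n)} :=
    LieSubalgebra.subset_lieSpan ⟨p, hp, rfl⟩
  by_cases hsi : s = i
  · subst hsi
    rw [lie_Bq_Bq_eq hij hj hi]
    exact LieSubalgebra.lie_mem _ (mem_top s hi) (mem_top j hj)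
  by_cases hsj : s = j
  · subst hsj
    rw [Bq_comm, lie_Bq_Bq_eq hij.symm hi hj]
    exact LieSubalgebra.lie_mem _ (mem_top s hj) (mem_top i hi)
  rw [lie_Bq_eq_zero_of_disjoint]
  · exact zero_mem _
  · ext x
    simp only [Set.mem_inter_iff, Set.mem_insert_iff, Set.mem_singleton_iff, Set.mem_empty_iff_false]
    grind
end

section
/- In a free Lie algebra L over ℤ on at least two generators, if b is a member of a free generating set and x is homogeneous of degree q ≥ 2 with [x,b] = 0, then x = 0. -/
/-- The degree-`q` homogeneous component of the free Lie algebra over ℤ on `X`,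
defined by the standard grading: degree 1 is spanned by the generators, and
degree `q+1` is spanned by brackets of degree-`q` elements with generators
(the free Lie algebra is generated in degree 1). -/
noncomputable def FreeLieAlgebra.homog (X : Type*) : ℕ → Submodule ℤ (FreeLieAlgebra ℤ X)
  | 0 => ⊥
  | 1 => Submodule.span ℤ (Set.range (FreeLieAlgebra.of ℤ (X := X)))
  | (q + 2) => Submodule.span ℤ
      {z | ∃ x ∈ FreeLieAlgebra.homog X (q + 1), ∃ s : X, z = ⁅x, FreeLieAlgebra.of ℤ s⁆}

attribute [local instance] LieRing.ofAssociativeRing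

/-- The trivial extension `L ⋉ M` of a Lie algebra `L` by a Lie module `M`, in which `M` is an
abelian ideal. -/
@[ext] structure LieTrivExt (L M : Type*) where
  /-- The component in the Lie algebra. -/
  fst : L
  /-- The component in the module. -/
  snd : M

namespace LieTrivExt

variable {R L M : Type*} [CommRing R] [LieRing L] [LieAlgebra R L] [AddCommGroup M] [Module R M]

/-- The trivial extension has the product as its underlying type. -/
def toProd : LieTrivExt L M ≃ L × M where
  toFun x := (x.fst, x.snd)
  invFun x := ⟨x.1, x.2⟩

instance : AddCommGroup (LieTrivExt L M) := toProd.addCommGroup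

instance : Module R (LieTrivExt L M) := toProd.module R

@[simp] lemma fst_zero : (0 : LieTrivExt L M).fst = 0 := rfl
@[simp] lemma snd_zero : (0 : LieTrivExt L M).snd = 0 := rfl
@[simp] lemma fst_add (x y : LieTrivExt L M) : (x + y).fst = x.fst + y.fst := rfl
@[simp] lemma snd_add (x y : LieTrivExt L M) : (x + y).snd = x.snd + y.snd := rfl
@[simp] lemma fst_smul (t : R) (x : LieTrivExt L M) : (t • x).fst = t • x.fst := rfl
@[simp] lemma snd_smul (t : R) (x : LieTrivExt L M) : (t • x).snd = t • x.snd := rfl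

variable [LieRingModule L M] [LieModule R L M]

instance : Bracket (LieTrivExt L M) (LieTrivExt L M) where
  bracket x y := ⟨⁅x.fst, y.fst⁆, ⁅x.fst, y.snd⁆ - ⁅y.fst, x.snd⁆⟩

@[simp] lemma fst_lie (x y : LieTrivExt L M) : ⁅x, y⁆.fst = ⁅x.fst, y.fst⁆ := rfl
@[simp] lemma snd_lie (x y : LieTrivExt L M) :
    ⁅x, y⁆.snd = ⁅x.fst, y.snd⁆ - ⁅y.fst, x.snd⁆ := rfl

instance : LieRing (LieTrivExt L M) where
  add_lie _ _ _ := by ext <;> simp; abel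
  lie_add _ _ _ := by ext <;> simp; abel
  lie_self _ := by ext <;> simp
  leibniz_lie _ _ _ := by ext <;> simp; abel

instance : LieAlgebra R (LieTrivExt L M) where
  lie_smul _ _ _ := by ext <;> simp [smul_sub]

variable (R L M) in
/-- The projection of the trivial extension onto the Lie algebra. -/
def fstHom : LieTrivExt L M →ₗ⁅R⁆ L where
  toFun := fst
  map_add' _ _ := rfl
  map_smul' _ _ := rfl
  map_lie' := rfl

@[simp] lemma fstHom_apply (x : LieTrivExt L M) : fstHom R L M x = x.fst := rfl

end LieTrivExt

namespace FreeLieAlgebra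

open LieAlgebra

universe u

variable {R : Type*} {X : Type u} [CommRing R]

@[elab_as_elim]
theorem induction_on {p : FreeLieAlgebra R X → Prop} (x : FreeLieAlgebra R X)
    (of : ∀ s, p (of R s)) (zero : p 0) (add : ∀ x y, p x → p y → p (x + y))
    (smul : ∀ (t : R) x, p x → p (t • x)) (lie : ∀ x y, p x → p y → p ⁅x, y⁆) : p x := by
  let K : LieSubalgebra R (FreeLieAlgebra R X) :=
    { carrier := {x | p x}
      zero_mem' := zero
      add_mem' := add _ _
      smul_mem' := smul
      lie_mem' := lie _ _ }
  let f : FreeLieAlgebra R X →ₗ⁅R⁆ K := lift R fun s ↦ ⟨FreeLieAlgebra.of R s, of s⟩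
  have hf : K.incl.comp f = LieHom.id := by
    ext s
    simp [f]
  have hx := LieHom.congr_fun hf x
  rw [LieHom.comp_apply, LieHom.id_apply] at hx
  exact hx ▸ (f x).2

section Derivation

variable {M : Type*} [AddCommGroup M] [Module R M] [LieRingModule (FreeLieAlgebra R X) M]
  [LieModule R (FreeLieAlgebra R X) M]

variable (R) in
/-- The homomorphism to the trivial extension encoding `FreeLieAlgebra.derivation`. -/
noncomputable def toTrivExt (f : X → M) :
    FreeLieAlgebra R X →ₗ⁅R⁆ LieTrivExt (FreeLieAlgebra R X) M :=
  lift R fun s ↦ ⟨of R s, f s⟩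

theorem toTrivExt_fst (f : X → M) (x : FreeLieAlgebra R X) : (toTrivExt R f x).fst = x := by
  have h : (LieTrivExt.fstHom R _ M).comp (toTrivExt R f) = LieHom.id := by
    ext s
    simp [toTrivExt]
  exact LieHom.congr_fun h x

variable (R) in
/-- The derivation of a free Lie algebra with prescribed values on the generators. -/
noncomputable def derivation (f : X → M) : LieDerivation R (FreeLieAlgebra R X) M where
  toFun x := (toTrivExt R f x).snd
  map_add' _ _ := by simp
  map_smul' _ _ := by simp
  leibniz' x y := by simp [toTrivExt_fst]

@[simp]
theorem derivation_of (f : X → M) (s : X) : derivation R f (of R s) = f s := by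
  change (toTrivExt R f (of R s)).snd = f s
  simp [toTrivExt]

end Derivation

section LengthFiltration

variable (R X) in
/-- The span of the left-normed brackets of at most `n` generators. -/
noncomputable def lengthLE : ℕ → Submodule R (FreeLieAlgebra R X)
  | 0 => ⊥
  | n + 1 => Submodule.span R (Set.range (of R)) ⊔
      Submodule.span R {z | ∃ x ∈ lengthLE n, ∃ s : X, z = ⁅x, of R s⁆}

theorem of_mem_lengthLE (n : ℕ) (s : X) : of R s ∈ lengthLE R X (n + 1) :=
  Submodule.mem_sup_left (Submodule.subset_span ⟨s, rfl⟩)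

theorem lie_of_mem_lengthLE {n : ℕ} {x : FreeLieAlgebra R X} (hx : x ∈ lengthLE R X n) (s : X) :
    ⁅x, of R s⁆ ∈ lengthLE R X (n + 1) :=
  Submodule.mem_sup_right (Submodule.subset_span ⟨x, hx, s, rfl⟩)

theorem lengthLE_succ_le {n : ℕ} {N : Submodule R (FreeLieAlgebra R X)}
    (hof : ∀ s, of R s ∈ N) (hlie : ∀ x ∈ lengthLE R X n, ∀ s, ⁅x, of R s⁆ ∈ N) :
    lengthLE R X (n + 1) ≤ N := by
  refine sup_le (Submodule.span_le.2 ?_) (Submodule.span_le.2 ?_)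
  · rintro _ ⟨s, rfl⟩
    exact hof s
  · rintro _ ⟨x, hx, s, rfl⟩
    exact hlie x hx s

theorem lengthLE_le_succ (n : ℕ) : lengthLE R X n ≤ lengthLE R X (n + 1) := by
  induction n with
  | zero => exact bot_le
  | succ n ih =>
    exact lengthLE_succ_le (of_mem_lengthLE _) fun x hx s ↦ lie_of_mem_lengthLE (ih hx) s

theorem derivation_mem_lengthLE (f : X → X) (n : ℕ) {x : FreeLieAlgebra R X}
    (hx : x ∈ lengthLE R X n) : derivation R (fun s ↦ of R (f s)) x ∈ lengthLE R X n := by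
  induction n generalizing x with
  | zero =>
    obtain rfl : x = 0 := hx
    rw [map_zero]
    exact zero_mem _
  | succ n ih =>
    suffices h : lengthLE R X (n + 1) ≤ (lengthLE R X (n + 1)).comap
        (derivation R (fun s ↦ of R (f s))).toLinearMap from h hx
    refine lengthLE_succ_le (fun s ↦ ?_) fun x hx s ↦ ?_
    · simpa using of_mem_lengthLE n (f s)
    · have h := add_mem (lie_of_mem_lengthLE hx (f s)) (lie_of_mem_lengthLE (ih hx) s)
      rw [← lie_skew (derivation R _ x), ← sub_eq_add_neg] at h
      simpa using h

theorem lift_mem_lengthLE {Y : Type*} {f : X → FreeLieAlgebra R Y}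
    (hf : ∀ s, f s = 0 ∨ ∃ t, f s = of R t) (n : ℕ) {x : FreeLieAlgebra R X}
    (hx : x ∈ lengthLE R X n) : lift R f x ∈ lengthLE R Y n := by
  induction n generalizing x with
  | zero =>
    obtain rfl : x = 0 := hx
    rw [map_zero]
    exact zero_mem _
  | succ n ih =>
    suffices h : lengthLE R X (n + 1) ≤ (lengthLE R Y (n + 1)).comap
        (lift R f : FreeLieAlgebra R X →ₗ[R] FreeLieAlgebra R Y) from h hx
    refine lengthLE_succ_le (fun s ↦ ?_) fun x hx s ↦ ?_
    · obtain h | ⟨t, h⟩ := hf s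
      · simp [h]
      · simpa [h] using of_mem_lengthLE n t
    · obtain h | ⟨t, h⟩ := hf s
      · simp [h]
      · simpa [h] using lie_of_mem_lengthLE (ih hx) t

end LengthFiltration

section Elimination

variable (R) (a : X)

/-- The generators `(ad a)ⁿ s`, for `s ≠ a`, produced by Lazard elimination of `a`. -/
abbrev ElimIndex : Type u := ℕ × {s : X // s ≠ a}

/-- The derivation shifting the generators of the eliminated algebra; it corresponds to `ad a`. -/
noncomputable def shift :
    LieDerivation R (FreeLieAlgebra R (ElimIndex a)) (FreeLieAlgebra R (ElimIndex a)) :=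
  derivation R fun t ↦ of R (t.1 + 1, t.2)

/-- The action of the one-dimensional Lie algebra by multiples of `FreeLieAlgebra.shift`. -/
noncomputable def shiftHom :
    R →ₗ⁅R⁆ LieDerivation R (FreeLieAlgebra R (ElimIndex a)) (FreeLieAlgebra R (ElimIndex a)) where
  __ := LinearMap.toSpanSingleton R _ (shift R a)
  map_lie' {x y} := by
    ext z
    simp [LieRing.of_associative_ring_bracket, mul_comm x y]

@[simp]
theorem shiftHom_apply (r : R) (y : FreeLieAlgebra R (ElimIndex a)) :
    shiftHom R a r y = r • shift R a y := rfl

open Classical in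
/-- The Lazard elimination homomorphism. -/
noncomputable def elim :
    FreeLieAlgebra R X →ₗ⁅R⁆ FreeLieAlgebra R (ElimIndex a) ⋊⁅shiftHom R a⁆ R :=
  lift R fun s ↦ if h : s = a then ⟨0, 1⟩ else ⟨of R (0, ⟨s, h⟩), 0⟩

open Classical in
/-- The homomorphism sending `a` to zero, with values in the eliminated algebra. -/
noncomputable def elimKill : FreeLieAlgebra R X →ₗ⁅R⁆ FreeLieAlgebra R (ElimIndex a) :=
  lift R fun s ↦ if h : s = a then 0 else of R (0, ⟨s, h⟩)

open Classical in
/-- The endomorphism sending `a` to zero and fixing the other generators. -/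
noncomputable def kill : FreeLieAlgebra R X →ₗ⁅R⁆ FreeLieAlgebra R X :=
  lift R fun s ↦ if s = a then 0 else of R s

@[simp] theorem elim_of_self : elim R a (of R a) = ⟨0, 1⟩ := by simp [elim]

theorem elim_of_ne {s : X} (h : s ≠ a) : elim R a (of R s) = ⟨of R (0, ⟨s, h⟩), 0⟩ := by
  simp [elim, h]

@[simp] theorem elimKill_of_self : elimKill R a (of R a) = 0 := by simp [elimKill]

theorem elimKill_of_ne {s : X} (h : s ≠ a) : elimKill R a (of R s) = of R (0, ⟨s, h⟩) := by
  simp [elimKill, h]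

@[simp] theorem kill_of_self : kill R a (of R a) = 0 := by simp [kill]

theorem kill_of_ne {s : X} (h : s ≠ a) : kill R a (of R s) = of R s := by simp [kill, h]

theorem kill_kill (x : FreeLieAlgebra R X) : kill R a (kill R a x) = kill R a x := by
  have h : (kill R a).comp (kill R a) = kill R a := by
    ext s
    by_cases hs : s = a
    · subst hs; simp
    · simp [kill_of_ne R a hs]
  exact LieHom.congr_fun h x

theorem elim_kill (x : FreeLieAlgebra R X) : elim R a (kill R a x) = ⟨elimKill R a x, 0⟩ := by
  have h : (elim R a).comp (kill R a) = (SemiDirectSum.inl (shiftHom R a)).comp (elimKill R a) := by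
    ext1 s
    by_cases hs : s = a
    · subst hs; simp
    · simp [kill_of_ne R a hs, elim_of_ne R a hs, elimKill_of_ne R a hs]
  exact LieHom.congr_fun h x

/-- The homomorphism from the eliminated algebra evaluating the generator `(n, s)` at
`(ad a)ⁿ s`. -/
noncomputable def elimEval : FreeLieAlgebra R (ElimIndex a) →ₗ⁅R⁆ FreeLieAlgebra R X :=
  lift R fun t ↦ (fun y ↦ ⁅of R a, y⁆)^[t.1] (of R t.2.1)

theorem elimEval_shift (y : FreeLieAlgebra R (ElimIndex a)) :
    elimEval R a (shift R a y) = ⁅of R a, elimEval R a y⁆ := by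
  induction y using induction_on with
  | of t => simp [shift, elimEval, Function.iterate_succ_apply']
  | zero => simp
  | add x y hx hy => simp [hx, hy]
  | smul t x hx => simp [hx]
  | lie x y hx hy =>
    rw [LieDerivation.apply_lie_eq_add, map_add, LieHom.map_lie, LieHom.map_lie, hx, hy,
      LieHom.map_lie, leibniz_lie (of R a), add_comm]

/-- The inverse of the Lazard elimination homomorphism. -/
noncomputable def elimInv :
    FreeLieAlgebra R (ElimIndex a) ⋊⁅shiftHom R a⁆ R →ₗ⁅R⁆ FreeLieAlgebra R X where
  toFun z := elimEval R a z.left + z.right • of R a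
  map_add' _ _ := by simp [add_smul]; abel
  map_smul' _ _ := by simp [mul_smul]
  map_lie' {x y} := by
    have h := lie_skew (of R a) (elimEval R a x.left)
    simp only [SemiDirectSum.lie_eq_mk, shiftHom_apply, map_add, map_sub, map_smul, LieHom.map_lie,
      elimEval_shift, LieRing.of_associative_ring_bracket, mul_comm x.right, sub_self, zero_smul,
      add_zero, lie_add, add_lie, lie_smul, smul_lie, lie_self, smul_zero]
    rw [← h, smul_neg]
    abel

theorem elim_injective : Function.Injective (elim R a) := by
  have h : (elimInv R a).comp (elim R a) = LieHom.id := by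
    ext s
    by_cases hs : s = a
    · subst hs; simp [elimInv]
    · simp [elim_of_ne R a hs, elimInv, elimEval]
  exact Function.LeftInverse.injective (g := elimInv R a) (LieHom.congr_fun h)

theorem elim_left_sub_mem_lengthLE (n : ℕ) {x : FreeLieAlgebra R X}
    (hx : x ∈ lengthLE R X (n + 1)) :
    (elim R a x).left - elimKill R a x ∈ lengthLE R (ElimIndex a) n := by
  induction n generalizing x with
  | zero =>
    suffices h : lengthLE R X 1 ≤ (lengthLE R (ElimIndex a) 0).comap
        ((SemiDirectSum.projl (shiftHom R a)).comp (elim R a : FreeLieAlgebra R X →ₗ[R] _) -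
          (elimKill R a : FreeLieAlgebra R X →ₗ[R] _)) from h hx
    refine lengthLE_succ_le (fun s ↦ ?_) fun x hx s ↦ ?_
    · by_cases hs : s = a
      · subst hs; simp
      · simp [elim_of_ne R a hs, elimKill_of_ne R a hs]
    · obtain rfl : x = 0 := hx
      simp
  | succ n ih =>
    suffices h : lengthLE R X (n + 2) ≤ (lengthLE R (ElimIndex a) (n + 1)).comap
        ((SemiDirectSum.projl (shiftHom R a)).comp (elim R a : FreeLieAlgebra R X →ₗ[R] _) -
          (elimKill R a : FreeLieAlgebra R X →ₗ[R] _)) from h hx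
    refine lengthLE_succ_le (fun s ↦ ?_) fun x hx s ↦ ?_
    · by_cases hs : s = a
      · subst hs; simp
      · simp [elim_of_ne R a hs, elimKill_of_ne R a hs]
    · have hd := ih hx
      by_cases hs : s = a
      · subst hs
        have hk : elimKill R s x ∈ lengthLE R (ElimIndex s) (n + 1) := by
          refine lift_mem_lengthLE (fun t ↦ ?_) _ hx
          split_ifs
          exacts [.inl rfl, .inr ⟨_, rfl⟩]
        have hl : (elim R s x).left ∈ lengthLE R (ElimIndex s) (n + 1) := by
          simpa using add_mem (lengthLE_le_succ n hd) hk
        simpa using! derivation_mem_lengthLE _ _ hl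
      · have h := add_mem (lie_of_mem_lengthLE hd (0, ⟨s, hs⟩))
          (Submodule.smul_mem _ (elim R a x).right (of_mem_lengthLE (R := R) n
            ((1, ⟨s, hs⟩) : ElimIndex a)))
        simp only [sub_lie] at h
        simpa [elim_of_ne R a hs, elimKill_of_ne R a hs, shift, sub_add_eq_add_sub] using h

end Elimination

open Classical in
variable (R) in
/-- The linear functional reading off the coefficient of a generator. -/
noncomputable def coeff (b : X) : FreeLieAlgebra R X →ₗ⁅R⁆ R := lift R fun s ↦ if s = b then 1 else 0

@[simp]
theorem coeff_of_self (b : X) : coeff R b (of R b) = 1 := by simp [coeff]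

theorem coeff_lie (b : X) (x y : FreeLieAlgebra R X) : coeff R b ⁅x, y⁆ = 0 := by
  simp [LieRing.of_associative_ring_bracket, mul_comm]

theorem mem_span_of_forall_kill_eq {b : X} {x : FreeLieAlgebra R X}
    (hx : ∀ a, a ≠ b → kill R a x = x) : x ∈ Submodule.span R {of R b} := by
  classical
  let φ (F : Finset X) : FreeLieAlgebra R X →ₗ⁅R⁆ FreeLieAlgebra R X :=
    lift R fun s ↦ if s ≠ b ∧ s ∈ F then 0 else of R s
  have hφ (F : Finset X) : φ F x = x := by
    induction F using Finset.induction_on with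
    | empty =>
      have h : φ ∅ = LieHom.id := by
        ext s
        simp [φ]
      simp [h]
    | insert a F _ ih =>
      by_cases hab : a = b
      · have h : φ (insert a F) = φ F := by
          ext s
          by_cases hs : s = b <;> simp [φ, hs, hab]
        rw [h, ih]
      · have h : φ (insert a F) = (φ F).comp (kill R a) := by
          ext s
          by_cases hs : s = a
          · subst hs; simp [φ, hab]
          · simp [φ, kill_of_ne R a hs, hs]
        rw [h, LieHom.comp_apply, hx a hab, ih]
  have key (y : FreeLieAlgebra R X) :
      ∃ F : Finset X, ∀ G, F ⊆ G → φ G y ∈ Submodule.span R {of R b} := by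
    induction y using induction_on with
    | of s =>
      refine ⟨{s}, fun G hG ↦ ?_⟩
      by_cases hs : s = b
      · simp [φ, hs, Submodule.mem_span_singleton_self]
      · simp [φ, hs, Finset.singleton_subset_iff.1 hG]
    | zero => exact ⟨∅, fun G _ ↦ by simp⟩
    | add x y hx hy =>
      obtain ⟨F, hF⟩ := hx
      obtain ⟨F', hF'⟩ := hy
      refine ⟨F ∪ F', fun G hG ↦ ?_⟩
      rw [map_add]
      exact add_mem (hF G (Finset.union_subset_left hG)) (hF' G (Finset.union_subset_right hG))
    | smul t x hx =>
      obtain ⟨F, hF⟩ := hx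
      refine ⟨F, fun G hG ↦ ?_⟩
      rw [map_smul]
      exact Submodule.smul_mem _ _ (hF G hG)
    | lie x y hx hy =>
      obtain ⟨F, hF⟩ := hx
      obtain ⟨F', hF'⟩ := hy
      refine ⟨F ∪ F', fun G hG ↦ ?_⟩
      obtain ⟨r, hr⟩ := Submodule.mem_span_singleton.1 (hF G (Finset.union_subset_left hG))
      obtain ⟨t, ht⟩ := Submodule.mem_span_singleton.1 (hF' G (Finset.union_subset_right hG))
      rw [LieHom.map_lie, ← hr, ← ht]
      simp
  obtain ⟨F, hF⟩ := key x
  exact hφ F ▸ hF F subset_rfl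

/-- The centralizer of a generator in a free Lie algebra is spanned by that generator. -/
theorem mem_span_of_lie_of_eq_zero (n : ℕ) {X : Type u} {x : FreeLieAlgebra R X}
    (hx : x ∈ lengthLE R X n) {b : X} (h : ⁅x, of R b⁆ = 0) :
    x ∈ Submodule.span R {of R b} := by
  induction n generalizing X with
  | zero =>
    obtain rfl : x = 0 := hx
    exact zero_mem _
  | succ n ih =>
    refine mem_span_of_forall_kill_eq fun a ha ↦ ?_
    have hb : b ≠ a := ha.symm
    set y := (elim R a x).left - elimKill R a x with hy
    set c := (elim R a x).right with hc
    have hdiff : elim R a (x - kill R a x) = ⟨y, c⟩ := by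
      rw [map_sub, elim_kill]
      simp [hy, hc]
    have hcomm : ⁅x - kill R a x, of R b⁆ = 0 := by
      have h' := congrArg (kill R a) h
      rw [LieHom.map_lie, kill_of_ne R a hb, map_zero] at h'
      rw [sub_lie, h, h', sub_zero]
    have hbr : ⁅y, of R ((0, ⟨b, hb⟩) : ElimIndex a)⁆ + c • of R (1, ⟨b, hb⟩) = 0 := by
      have h' := congrArg (elim R a) hcomm
      rw [LieHom.map_lie, hdiff, elim_of_ne R a hb, map_zero] at h'
      simpa [shift] using congrArg SemiDirectSum.left h'
    have hc0 : c = 0 := by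
      have h' := congrArg (coeff R ((1, ⟨b, hb⟩) : ElimIndex a)) hbr
      rw [map_add, coeff_lie] at h'
      simpa using h'
    rw [hc0, zero_smul, add_zero] at hbr
    obtain ⟨k, hk⟩ := Submodule.mem_span_singleton.1
      (ih (elim_left_sub_mem_lengthLE R a n hx) hbr)
    have hx' : x - kill R a x = k • of R b := by
      apply elim_injective R a
      rw [hdiff, map_smul, elim_of_ne R a hb, hc0, hy, ← hk]
      simp
    have h0 := congrArg (kill R a) hx'
    rw [map_sub, kill_kill, sub_self, map_smul, kill_of_ne R a hb, ← hx'] at h0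
    exact (sub_eq_zero.1 h0.symm).symm

theorem homog_le_lengthLE (q : ℕ) : homog X q ≤ lengthLE ℤ X q := by
  induction q using homog.induct with
  | case1 => exact bot_le
  | case2 => exact le_sup_left
  | case3 q ih =>
    refine Submodule.span_le.2 ?_
    rintro _ ⟨x, hx, s, rfl⟩
    exact lie_of_mem_lengthLE (ih hx) s

end FreeLieAlgebra

/-- In a free Lie algebra over ℤ on at least two generators, a homogeneous element of
degree `q ≥ 2` commuting with a generator `b` must vanish. -/
theorem homogeneous_commuting_with_generator_eq_zero (S : Type*) (b : S)
    (hS : ∃ x y : S, x ≠ y) (q : ℕ) (hq : 2 ≤ q) (x : FreeLieAlgebra ℤ S)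
    (hx : x ∈ FreeLieAlgebra.homog S q) (h : ⁅x, FreeLieAlgebra.of ℤ b⁆ = 0) :
    x = 0 := by
  obtain ⟨k, rfl⟩ := Submodule.mem_span_singleton.1
    (FreeLieAlgebra.mem_span_of_lie_of_eq_zero q (FreeLieAlgebra.homog_le_lengthLE q hx) h)
  obtain ⟨q, rfl⟩ := Nat.exists_eq_add_of_le' hq
  have hker : FreeLieAlgebra.homog S (q + 2) ≤
      LinearMap.ker (FreeLieAlgebra.coeff ℤ b).toLinearMap := by
    refine Submodule.span_le.2 ?_
    rintro _ ⟨x, -, s, rfl⟩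
    exact FreeLieAlgebra.coeff_lie b x _
  have hk : FreeLieAlgebra.coeff ℤ b (k • FreeLieAlgebra.of ℤ b) = 0 := hker hx
  rw [map_smul, FreeLieAlgebra.coeff_of_self, smul_eq_mul, mul_one] at hk
  exact hk ▸ zero_smul ℤ (FreeLieAlgebra.of ℤ b)
end
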